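/- If two symbolic matrix bisystems satisfying FPCC are properly strong shift equivalent in 1-step, then their presenting subshifts are topologically conjugate. -/

import Mathlib

/-- The shift homeomorphism `σ` on the full shift: `(σ x) n = x (n+1)`. -/
def shiftMap {A : Type} (x : ℤ → A) : ℤ → A := fun n => x (n + 1)

/-- A subshift: a closed, shift-invariant subset of the full shift `A^ℤ`
(with `A` carrying the discrete topology and `A^ℤ` the product topology). -/
def IsSubshift {A : Type} [TopologicalSpace A] (Λ : Set (ℤ → A)) : Prop :=
  IsClosed Λ ∧ shiftMap '' Λ = Λ

/-- Replace the coordinates strictly between `k` and `l` of `x` by those of `μ`. -/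
def splice {A : Type} (x : ℤ → A) (k l : ℤ) (μ : ℤ → A) : ℤ → A :=
  fun n => if k < n ∧ n < l then μ n else x n

/-- `W_{k,l}(x)`: the set of words (recorded on the coordinates strictly between `k`
and `l`) which can be inserted between `x_{(-∞,k]}` and `x_{[l,∞)}` inside `Λ`. -/
def WSet {A : Type} (Λ : Set (ℤ → A)) (k l : ℤ) (x : ℤ → A) : Set (ℤ → A) :=
  { μ | splice x k l μ ∈ Λ }
/-- The set of (nonempty) admissible words of a subshift. -/
def lang {A : Type} (Λ : Set (ℤ → A)) : Set (List A) :=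
  { w | w ≠ [] ∧ ∃ x ∈ Λ, ∃ i : ℤ, ∀ j : Fin w.length, w.get j = x (i + (j : ℕ)) }
/-- Topological conjugacy of two subshifts: a shift-commuting homeomorphism. -/
def TopConj {A B : Type} [TopologicalSpace A] [TopologicalSpace B]
    (Λ₁ : Set (ℤ → A)) (Λ₂ : Set (ℤ → B)) : Prop :=
  ∃ h : ↥Λ₁ ≃ₜ ↥Λ₂,
    ∀ (x : ℤ → A) (hx : x ∈ Λ₁) (hx' : shiftMap x ∈ Λ₁),
      (h ⟨shiftMap x, hx'⟩).1 = shiftMap (h ⟨x, hx⟩).1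
/-- Product of two symbolic matrices: the entries of the product of a symbolic matrix
over `C` and a symbolic matrix over `D` are formal sums (multisets) of two-letter
words in `C·D`. -/
def symMul {I J K C D : Type} [Fintype J]
    (A : I → J → Multiset C) (B : J → K → Multiset D) : I → K → Multiset (C × D) :=
  fun i k => ∑ j : J, (A i j).bind fun a => (B j k).map fun b => (a, b)
/-- The underlying data of a symbolic matrix bisystem: sequences of `m l × m (l+1)`
symbolic matrices (entries are formal sums, i.e. multisets, of symbols). -/
structure SMBData (Sm Sp : Type) where
  m : ℕ → ℕ
  Mm : ∀ l, Fin (m l) → Fin (m (l + 1)) → Multiset Sm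
  Mp : ∀ l, Fin (m l) → Fin (m (l + 1)) → Multiset Sp

/-- The axioms making the data `M` a symbolic matrix bisystem: nonzero rows and
columns, no repeated symbol in an entry, no symbol repeated across the rows of a
column (right/left resolving), and the κ-commutation relation
`M⁻_{l,l+1} M⁺_{l+1,l+2} ≃_κ M⁺_{l,l+1} M⁻_{l+1,l+2}`. -/
structure IsSMB {Sm Sp : Type} (M : SMBData Sm Sp) : Prop where
  mpos : ∀ l, 0 < M.m l
  row_m : ∀ l i, ∃ j, M.Mm l i j ≠ 0
  col_m : ∀ l j, ∃ i, M.Mm l i j ≠ 0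
  row_p : ∀ l i, ∃ j, M.Mp l i j ≠ 0
  col_p : ∀ l j, ∃ i, M.Mp l i j ≠ 0
  nodup_m : ∀ l i j, (M.Mm l i j).Nodup
  nodup_p : ∀ l i j, (M.Mp l i j).Nodup
  res_m : ∀ l j i i' a, a ∈ M.Mm l i j → a ∈ M.Mm l i' j → i = i'
  res_p : ∀ l j i i' a, a ∈ M.Mp l i j → a ∈ M.Mp l i' j → i = i'
  commute : ∀ l i j,
    (symMul (M.Mm l) (M.Mp (l + 1)) i j).map Prod.swap = symMul (M.Mp l) (M.Mm (l + 1)) i j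

/-- Entries of the product of `k` consecutive symbolic matrices starting at level `n`:
formal sums of words of length `k`. -/
def prodFrom {S : Type} {m : ℕ → ℕ}
    (M : ∀ l, Fin (m l) → Fin (m (l + 1)) → Multiset S) (n : ℕ) :
    (k : ℕ) → Fin (m n) → Fin (m (n + k)) → Multiset (List S)
  | 0, i, j => if i = j then {[]} else 0
  | k + 1, i, j =>
      ∑ p : Fin (m (n + k)),
        (prodFrom M n k i p).bind fun w => (M (n + k) p j).map fun a => w ++ [a]

/-- FPCC for a symbolic matrix bisystem over a common alphabet: it is standard
(`m 0 = 1`) and for every `l ≥ 1` the words appearing in the `(1,j)` entry of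
`M⁻_{0,1}⋯M⁻_{l-1,l}` are exactly the reversed words appearing in the `(1,j)` entry
of `M⁺_{0,1}⋯M⁺_{l-1,l}`. -/
def SMBData.FPCC {S : Type} (M : SMBData S S) : Prop :=
  M.m 0 = 1 ∧
  ∀ l : ℕ, 1 ≤ l → ∀ (i : Fin (M.m 0)) (j : Fin (M.m (0 + l))) (w : List S),
    w ∈ prodFrom M.Mm 0 l i j ↔ w.reverse ∈ prodFrom M.Mp 0 l i j

/-- The set of nonempty admissible words of the presenting subshift of a symbolic
matrix bisystem: the words appearing as entries of products
`M⁺_{l,l+1} M⁺_{l+1,l+2} ⋯ M⁺_{l+k-1,l+k}`. -/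
def smbWords {S : Type} (M : SMBData S S) : Set (List S) :=
  { w | w ≠ [] ∧ ∃ (n k : ℕ) (i : Fin (M.m n)) (j : Fin (M.m (n + k))),
      w ∈ prodFrom M.Mp n k i j }
/-- The data of a properly strong shift equivalence in 1-step between two symbolic
matrix bisystems `M` (over `Σ_M`) and `N` (over `Σ_N`), with alphabets `C, D`,
specifications `φ : Σ_M → C·D`, `ψ : Σ_N → D·C`, and matrices `P_l` over `C`, `Q_l`
over `D`, `X_l` over `D` and `Y_l` over `C` (the parity-dependent families `X, Y`
are recorded as `Xe l = X_{2l}`, `Xo l = X_{2l+1}`, `Ye l = Y_{2l}`, `Yo l = Y_{2l+1}`),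
subject to the defining specified equivalences. -/
structure PSSE1Data (C D : Type) {SM SN : Type} (M : SMBData SM SM) (N : SMBData SN SN) where
  φ : SM → C × D
  ψ : SN → D × C
  φ_inj : Function.Injective φ
  ψ_inj : Function.Injective ψ
  c : ℕ → ℕ
  d : ℕ → ℕ
  hc : ∀ l, c (2 * l) = M.m l
  hd : ∀ l, d (2 * l) = N.m l
  P : ∀ l, Fin (c l) → Fin (d (l + 1)) → Multiset C
  Q : ∀ l, Fin (d l) → Fin (c (l + 1)) → Multiset D
  Xe : ∀ l, Fin (c (2 * l)) → Fin (c (2 * l + 1)) → Multiset D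
  Xo : ∀ l, Fin (d (2 * l + 1)) → Fin (d (2 * l + 2)) → Multiset D
  Ye : ∀ l, Fin (d (2 * l)) → Fin (d (2 * l + 1)) → Multiset C
  Yo : ∀ l, Fin (c (2 * l + 1)) → Fin (c (2 * l + 2)) → Multiset C
  hMp : ∀ l i j, (M.Mp l i j).map φ =
    symMul (P (2 * l)) (Q (2 * l + 1)) (Fin.cast (hc l).symm i) (Fin.cast (hc (l + 1)).symm j)
  hNp : ∀ l i j, (N.Mp l i j).map ψ =
    symMul (Q (2 * l)) (P (2 * l + 1)) (Fin.cast (hd l).symm i) (Fin.cast (hd (l + 1)).symm j)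
  hMm : ∀ l i j, (M.Mm l i j).map (Prod.swap ∘ φ) =
    symMul (Xe l) (Yo l) (Fin.cast (hc l).symm i) (Fin.cast (hc (l + 1)).symm j)
  hNm : ∀ l i j, (N.Mm l i j).map (Prod.swap ∘ ψ) =
    symMul (Ye l) (Xo l) (Fin.cast (hd l).symm i) (Fin.cast (hd (l + 1)).symm j)
  hYP : ∀ l i j, (symMul (Yo l) (P (2 * l + 2)) i j).map Prod.swap =
    symMul (P (2 * l + 1)) (Ye (l + 1)) i j
  hXQ : ∀ l i j, (symMul (Xo l) (Q (2 * l + 2)) i j).map Prod.swap =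
    symMul (Q (2 * l + 1)) (Xe (l + 1)) i j
  hXP : ∀ l i j, (symMul (Xe l) (P (2 * l + 1)) i j).map Prod.swap =
    symMul (P (2 * l)) (Xo l) i j
  hYQ : ∀ l i j, (symMul (Ye l) (Q (2 * l + 1)) i j).map Prod.swap =
    symMul (Q (2 * l)) (Yo l) i j

/-- Properly strong shift equivalence in 1-step. -/
def PSSE1 {SM SN : Type} (M : SMBData SM SM) (N : SMBData SN SN) : Prop :=
  ∃ C D : Type, Nonempty (PSSE1Data C D M N)

/-- The word `x n, x (n + 1), …, x (n + k - 1)` of a bi-infinite sequence. -/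
def window {S : Type} (x : ℤ → S) : ℤ → ℕ → List S
  | _, 0 => []
  | n, k + 1 => x n :: window x (n + 1) k

@[simp]
theorem length_window {S : Type} (x : ℤ → S) (n : ℤ) (k : ℕ) : (window x n k).length = k := by
  induction k generalizing n with
  | zero => rfl
  | succ k ih => simp [window, ih]

theorem getElem_window {S : Type} (x : ℤ → S) (n : ℤ) (k j : ℕ)
    (hj : j < (window x n k).length) : (window x n k)[j] = x (n + j) := by
  induction k generalizing n j with
  | zero => simp at hj
  | succ k ih =>
    cases j with
    | zero => simp [window]
    | succ j =>
      simp only [window, List.getElem_cons_succ]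
      rw [ih]
      congr 1
      push_cast
      ring

theorem map_window {S T : Type} (f : S → T) (x : ℤ → S) (n : ℤ) (k : ℕ) :
    (window x n k).map f = window (fun i => f (x i)) n k := by
  induction k generalizing n with
  | zero => rfl
  | succ k ih => simp [window, ih]

theorem window_mem_lang {S : Type} {Λ : Set (ℤ → S)} {x : ℤ → S} (hx : x ∈ Λ) (n : ℤ) (k : ℕ) :
    window x n (k + 1) ∈ lang Λ :=
  ⟨by simp [window], x, hx, n, fun j => by simp [getElem_window]⟩

/-- A subshift is invariant under all powers of the shift. -/
theorem IsSubshift.translate_mem {S : Type} [TopologicalSpace S] {Λ : Set (ℤ → S)}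
    (hΛ : IsSubshift Λ) {x : ℤ → S} (hx : x ∈ Λ) (m : ℤ) : (fun n => x (n + m)) ∈ Λ := by
  induction m using Int.induction_on with
  | zero => simpa using hx
  | succ m ih =>
    rw [← hΛ.2]
    refine ⟨_, ih, ?_⟩
    funext n
    simp only [shiftMap]
    congr 1
    ring
  | pred m ih =>
    rw [← hΛ.2] at ih
    obtain ⟨y, hy, hyx⟩ := ih
    convert hy using 1
    funext n
    have h := congrFun hyx (n - 1)
    simp only [shiftMap, sub_add_cancel] at h
    rw [h]
    congr 1
    ring

/-- A sequence all of whose finite words are admissible belongs to the subshift. -/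
theorem IsSubshift.mem_of_window_mem_lang {S : Type} [TopologicalSpace S] {Λ : Set (ℤ → S)}
    (hΛ : IsSubshift Λ) {y : ℤ → S} (hy : ∀ n k, window y n (k + 1) ∈ lang Λ) : y ∈ Λ := by
  have agree : ∀ k : ℕ, ∃ z ∈ Λ, ∀ n : ℤ, -k ≤ n → n ≤ k → z n = y n := by
    intro k
    obtain ⟨-, z, hz, i, hi⟩ := hy (-k) (2 * k)
    refine ⟨_, hΛ.translate_mem hz (i + k), fun n h₁ h₂ => ?_⟩
    obtain ⟨j, hj⟩ := Int.eq_ofNat_of_zero_le (show 0 ≤ n + k by omega)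
    have h := hi ⟨j, by rw [length_window]; omega⟩
    simp only [List.get_eq_getElem, getElem_window] at h
    rw [show n + (i + k) = i + j by omega, ← h]
    congr 1
    omega
  choose z hzΛ hz using agree
  refine hΛ.1.mem_of_tendsto (f := z) (b := Filter.atTop) ?_ (Filter.Eventually.of_forall hzΛ)
  refine tendsto_pi_nhds.2 fun n => ?_
  refine tendsto_const_nhds.congr' ?_
  filter_upwards [Filter.eventually_ge_atTop n.natAbs] with k hk
  exact (hz k n (by omega) (by omega)).symm

theorem mem_symMul {I J K C D : Type} [Fintype J] {U : I → J → Multiset C}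
    {V : J → K → Multiset D} {i : I} {k : K} {p : C × D} :
    p ∈ symMul U V i k ↔ ∃ j, p.1 ∈ U i j ∧ p.2 ∈ V j k := by
  obtain ⟨a, b⟩ := p
  simp [symMul, Multiset.mem_sum]

/-- A word is the label of a path starting at the vertex `i` of level `n`. -/
def IsPath {S : Type} {m : ℕ → ℕ} (M : ∀ l, Fin (m l) → Fin (m (l + 1)) → Multiset S) :
    (n : ℕ) → Fin (m n) → List S → Prop
  | _, _, [] => True
  | n, i, a :: w => ∃ j, a ∈ M n i j ∧ IsPath M (n + 1) j w

theorem isPath_append {S : Type} {m : ℕ → ℕ}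
    {M : ∀ l, Fin (m l) → Fin (m (l + 1)) → Multiset S} {n : ℕ} {i : Fin (m n)} (k : ℕ)
    {p : Fin (m (n + k))} {w v : List S} (hw : w ∈ prodFrom M n k i p)
    (hv : IsPath M (n + k) p v) : IsPath M n i (w ++ v) := by
  induction k generalizing w v with
  | zero =>
    by_cases h : i = p
    · subst h
      obtain rfl : w = [] := by simpa [prodFrom] using hw
      exact hv
    · simp [prodFrom, h] at hw
  | succ k ih =>
    simp only [prodFrom, Multiset.mem_sum, Finset.mem_univ, true_and, Multiset.mem_bind,
      Multiset.mem_map] at hw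
    obtain ⟨q, u, hu, a, ha, rfl⟩ := hw
    rw [List.append_assoc]
    exact ih hu ⟨p, ha, hv⟩

theorem exists_append_mem_prodFrom {S : Type} {m : ℕ → ℕ}
    {M : ∀ l, Fin (m l) → Fin (m (l + 1)) → Multiset S} {n k : ℕ} {i : Fin (m n)}
    {p : Fin (m (n + k))} {w : List S} (v : List S) (hw : w ∈ prodFrom M n k i p)
    (hv : IsPath M (n + k) p v) : ∃ k' j, w ++ v ∈ prodFrom M n k' i j := by
  induction v generalizing k w with
  | nil => exact ⟨k, p, by simpa using hw⟩
  | cons a v ih =>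
    obtain ⟨j, ha, hv⟩ := hv
    rw [List.append_cons]
    refine ih (k := k + 1) (p := j) ?_ hv
    simp only [prodFrom, Multiset.mem_sum, Finset.mem_univ, true_and, Multiset.mem_bind,
      Multiset.mem_map]
    exact ⟨p, w, hw, a, ha, rfl⟩

theorem mem_smbWords_iff {S : Type} {M : SMBData S S} {w : List S} :
    w ∈ smbWords M ↔ w ≠ [] ∧ ∃ n i, IsPath M.Mp n i w := by
  refine and_congr_right fun _ => ⟨?_, ?_⟩
  · rintro ⟨n, k, i, j, hw⟩
    exact ⟨n, i, by simpa using isPath_append k hw (v := []) trivial⟩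
  · rintro ⟨n, i, hw⟩
    obtain ⟨k, j, h⟩ := exists_append_mem_prodFrom (M := M.Mp) (k := 0) (i := i) (p := i)
      (w := []) w (by simp [prodFrom]) hw
    exact ⟨n, k, i, j, h⟩

namespace PSSE1Data

variable {A B C D : Type} {M : SMBData A A} {N : SMBData B B}

/-- Properly strong shift equivalence in 1-step is a symmetric relation. -/
def symm (E : PSSE1Data C D M N) : PSSE1Data D C N M where
  φ := E.ψ
  ψ := E.φ
  φ_inj := E.ψ_inj
  ψ_inj := E.φ_inj
  c := E.d
  d := E.c
  hc := E.hd
  hd := E.hc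
  P := E.Q
  Q := E.P
  Xe := E.Ye
  Xo := E.Yo
  Ye := E.Xe
  Yo := E.Xo
  hMp := E.hNp
  hNp := E.hMp
  hMm := E.hNm
  hNm := E.hMm
  hYP := E.hXQ
  hXQ := E.hYP
  hXP := E.hYQ
  hYQ := E.hXP

theorem exists_mem_Xe (E : PSSE1Data C D M N) (hM : IsSMB M) (l : ℕ) (i : Fin (M.m l)) :
    ∃ i' s, s ∈ E.Xe l (Fin.cast (E.hc l).symm i) i' := by
  obtain ⟨j, hj⟩ := hM.row_m l i
  obtain ⟨a, ha⟩ := Multiset.exists_mem_of_ne_zero hj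
  have h := Multiset.mem_map_of_mem (Prod.swap ∘ E.φ) ha
  rw [E.hMm, mem_symMul] at h
  obtain ⟨k, hk, -⟩ := h
  exact ⟨k, _, hk⟩

/-- The pair of consecutive half-symbols straddling positions `n` and `n + 1`. -/
def straddle (E : PSSE1Data C D M N) (x : ℤ → A) (n : ℤ) : D × C :=
  ((E.φ (x n)).2, (E.φ (x (n + 1))).1)

/-- The half-symbols along a path of `M` can be read, after moving along an edge of `X`, on a
path of `N` one level higher. -/
theorem exists_isPath_straddle (E : PSSE1Data C D M N) (hM : IsSMB M) (x : ℤ → A) (k : ℕ)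
    (n : ℤ) (l : ℕ) (i : Fin (M.m l)) (h : IsPath M.Mp l i (window x n k)) :
    ∃ i', (∃ s, s ∈ E.Xe l (Fin.cast (E.hc l).symm i) i') ∧
      ∀ k', k = k' + 1 → ∃ r : Fin (N.m (l + 1)),
        (E.φ (x n)).1 ∈ E.P (2 * l + 1) i' (Fin.cast (E.hd (l + 1)).symm r) ∧
        ∃ v, IsPath N.Mp (l + 1) r v ∧ v.map E.ψ = window (E.straddle x) n k' := by
  induction k generalizing n l with
  | zero =>
    obtain ⟨i', s, hs⟩ := E.exists_mem_Xe hM l i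
    exact ⟨i', ⟨s, hs⟩, fun k' hk' => absurd hk' (by omega)⟩
  | succ k ih =>
    obtain ⟨j, ha, hw⟩ := h
    have hpq := Multiset.mem_map_of_mem E.φ ha
    rw [E.hMp, mem_symMul] at hpq
    obtain ⟨t, hp, hq⟩ := hpq
    obtain ⟨j', ⟨s, hs⟩, hj'⟩ := ih (n + 1) (l + 1) j hw
    have hQX : ((E.φ (x n)).2, s) ∈ symMul (E.Q (2 * l + 1)) (E.Xe (l + 1)) t j' :=
      mem_symMul.2 ⟨_, hq, hs⟩
    rw [← E.hXQ, Multiset.mem_map] at hQX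
    obtain ⟨⟨s₁, q⟩, hXQ, heq⟩ := hQX
    obtain ⟨rfl, rfl⟩ := Prod.mk.inj heq
    obtain ⟨t', hs₁, hq'⟩ := mem_symMul.1 hXQ
    have hPX : ((E.φ (x n)).1, s₁) ∈ symMul (E.P (2 * l)) (E.Xo l)
        (Fin.cast (E.hc l).symm i) t' := mem_symMul.2 ⟨_, hp, hs₁⟩
    rw [← E.hXP, Multiset.mem_map] at hPX
    obtain ⟨⟨s₂, p⟩, hXP, heq⟩ := hPX
    obtain ⟨rfl, rfl⟩ := Prod.mk.inj heq
    obtain ⟨i', hs₂, hp'⟩ := mem_symMul.1 hXP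
    refine ⟨i', ⟨s₂, hs₂⟩, fun k' hk' => ⟨Fin.cast (E.hd (l + 1)) t', hp', ?_⟩⟩
    obtain rfl : k = k' := by omega
    cases k with
    | zero => exact ⟨[], trivial, rfl⟩
    | succ k =>
      obtain ⟨r, hr, v, hv, hvw⟩ := hj' k rfl
      have hQP : E.straddle x n ∈ symMul (E.Q (2 * (l + 1))) (E.P (2 * (l + 1) + 1)) t'
          (Fin.cast (E.hd (l + 2)).symm r) := mem_symMul.2 ⟨j', hq', hr⟩
      have hN := E.hNp (l + 1) (Fin.cast (E.hd (l + 1)) t') r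
      rw [Fin.cast_cast, Fin.cast_eq_self] at hN
      rw [← hN, Multiset.mem_map] at hQP
      obtain ⟨b, hb, hbx⟩ := hQP
      exact ⟨b :: v, ⟨r, hb, hv⟩, by simp [window, hbx, hvw]⟩

theorem exists_mem_subshift [TopologicalSpace B] (E : PSSE1Data C D M N) (hM : IsSMB M)
    {ΛM : Set (ℤ → A)} {ΛN : Set (ℤ → B)} (hLM : lang ΛM = smbWords M) (hΛN : IsSubshift ΛN)
    (hLN : lang ΛN = smbWords N) {x : ℤ → A} (hx : x ∈ ΛM) :
    ∃ y ∈ ΛN, ∀ n, E.ψ (y n) = E.straddle x n := by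
  have words : ∀ n k, ∃ v ∈ lang ΛN, v.map E.ψ = window (E.straddle x) n (k + 1) := by
    intro n k
    have hw := window_mem_lang hx n (k + 1)
    rw [hLM, mem_smbWords_iff] at hw
    obtain ⟨-, l, i, hp⟩ := hw
    obtain ⟨_, -, h⟩ := E.exists_isPath_straddle hM x _ n l i hp
    obtain ⟨r, -, v, hv, hvw⟩ := h (k + 1) rfl
    refine ⟨v, ?_, hvw⟩
    rw [hLN, mem_smbWords_iff]
    refine ⟨?_, _, r, hv⟩
    rintro rfl
    simp [window] at hvw
  have letters : ∀ n, ∃ b, E.ψ b = E.straddle x n := by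
    intro n
    obtain ⟨v, -, hv⟩ := words n 0
    cases v with
    | nil => simp [window] at hv
    | cons b v => exact ⟨b, (List.cons.inj hv).1⟩
  choose y hy using letters
  refine ⟨y, hΛN.mem_of_window_mem_lang fun n k => ?_, hy⟩
  obtain ⟨v, hv, hvw⟩ := words n k
  rw [← funext hy, ← map_window] at hvw
  rwa [← E.ψ_inj.list_map hvw]

end PSSE1Data

/-- if two symbolic matrix bisystems satisfying FPCC are properly
strong shift equivalent in 1-step, their presenting subshifts are topologically
conjugate. -/
theorem stmt_12 {A B : Type} [Finite A] [Finite B]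
    [TopologicalSpace A] [DiscreteTopology A] [TopologicalSpace B] [DiscreteTopology B]
    (M : SMBData A A) (N : SMBData B B)
    (hMs : IsSMB M) (hMf : M.FPCC) (hNs : IsSMB N) (hNf : N.FPCC)
    (ΛM : Set (ℤ → A)) (ΛN : Set (ℤ → B))
    (hΛM : IsSubshift ΛM) (hLM : lang ΛM = smbWords M)
    (hΛN : IsSubshift ΛN) (hLN : lang ΛN = smbWords N)
    (h : PSSE1 M N) :
    TopConj ΛM ΛN := by
  obtain ⟨C, D, ⟨E⟩⟩ := h
  choose f hfΛ hf using fun x : ↥ΛM => E.exists_mem_subshift hMs hLM hΛN hLN x.2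
  let F : ↥ΛM → ↥ΛN := fun x => ⟨f x, hfΛ x⟩
  have continuous_F : Continuous F := by
    refine Continuous.subtype_mk (continuous_pi fun n => ?_) _
    refine continuous_iff_continuousAt.2 fun x => ?_
    refine tendsto_const_nhds.congr' ?_
    have coord : ∀ m : ℤ, ∀ᶠ x' : ↥ΛM in nhds x, x'.1 m = x.1 m := fun m =>
      ((continuous_apply m).comp continuous_subtype_val).continuousAt.eventually
        (isOpen_discrete {x.1 m} |>.mem_nhds rfl)
    filter_upwards [coord n, coord (n + 1)] with x' h₁ h₂
    apply E.ψ_inj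
    rw [hf, hf, PSSE1Data.straddle, PSSE1Data.straddle, h₁, h₂]
  have injective_F : Function.Injective F := by
    intro x x' h
    have hxx' : ∀ n, E.straddle x.1 n = E.straddle x'.1 n := fun n => by
      rw [← hf, ← hf, show f x = f x' from congrArg Subtype.val h]
    refine Subtype.ext (funext fun n => E.φ_inj (Prod.ext ?_ (Prod.mk.inj (hxx' n)).1))
    simpa using (Prod.mk.inj (hxx' (n - 1))).2
  have surjective_F : Function.Surjective F := by
    intro y
    obtain ⟨x, hx, hxy⟩ := E.symm.exists_mem_subshift hNs hLN hΛM hLM y.2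
    refine ⟨⟨_, hΛM.translate_mem hx (-1)⟩, Subtype.ext (funext fun n => E.ψ_inj ?_)⟩
    have hφ : ∀ n, E.φ (x n) = ((E.ψ (y.1 n)).2, (E.ψ (y.1 (n + 1))).1) := hxy
    simp [F, hf, PSSE1Data.straddle, hφ]
  have : CompactSpace ↥ΛM := isCompact_iff_compactSpace.1 hΛM.1.isCompact
  refine ⟨continuous_F.homeoOfEquivCompactToT2
    (f := Equiv.ofBijective F ⟨injective_F, surjective_F⟩), fun x hx hx' => ?_⟩
  refine funext fun n => E.ψ_inj ?_
  change E.ψ (f ⟨shiftMap x, hx'⟩ n) = E.ψ (f ⟨x, hx⟩ (n + 1))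
  rw [hf, hf]
  rfl
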